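/- arXiv:1812.08022 — 3 statements merged into one kernel-verified Lean document; each statement's English description precedes it below -/
import Mathlib

section
/- Let q be a primitive block of size m × n that does not satisfy condition (*). Then for every k ≥ 1, the number of k × k blocks occurring in configurations of X_q satisfies |L_{k,k}(X_q)| ≤ (2k+1)² · (mn)^{2k+1}. -/
open Filter

variable {A : Type*}

/-- The `m × n` block `q` occurs at position `(x, y)` in the configuration `w`:
`w (x+i) (y+j) = q i j` for all `0 ≤ i < m`, `0 ≤ j < n`. -/
def OccursAt (m n : ℕ) (q w : ℤ → ℤ → A) (x y : ℤ) : Prop :=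
  ∀ i j : ℤ, 0 ≤ i → i < (m : ℤ) → 0 ≤ j → j < (n : ℤ) → w (x + i) (y + j) = q i j

/-- The occurrence of the `m × n` block `q` at `(x, y)` in `w` covers position `(p₁, p₂)`. -/
def CoversPos (m n : ℕ) (q w : ℤ → ℤ → A) (x y p₁ p₂ : ℤ) : Prop :=
  OccursAt m n q w x y ∧ x ≤ p₁ ∧ p₁ < x + (m : ℤ) ∧ y ≤ p₂ ∧ p₂ < y + (n : ℤ)

/-- `w` is `q`-coverable: every position of `ℤ²` is covered by an occurrence of `q`. -/
def Coverable (m n : ℕ) (q w : ℤ → ℤ → A) : Prop :=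
  ∀ p₁ p₂ : ℤ, ∃ x y : ℤ, CoversPos m n q w x y p₁ p₂

/-- `Xq m n q` is the set of all `q`-coverable configurations. -/
def Xq (m n : ℕ) (q : ℤ → ℤ → A) : Set (ℤ → ℤ → A) :=
  {w | Coverable m n q w}

/-- A `u × v` block occurring at the bottom-left and top-right corners of the `m × n`
block `q`, different from `q` itself: a border of `q` along the BL/TR diagonal. -/
def IsBorderBLTR (m n u v : ℕ) (q : ℤ → ℤ → A) : Prop :=
  0 < u ∧ u ≤ m ∧ 0 < v ∧ v ≤ n ∧ ¬(u = m ∧ v = n) ∧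
    ∀ i j : ℤ, 0 ≤ i → i < (u : ℤ) → 0 ≤ j → j < (v : ℤ) →
      q i j = q ((m : ℤ) - (u : ℤ) + i) ((n : ℤ) - (v : ℤ) + j)

/-- A `u × v` block occurring at the top-left and bottom-right corners of the `m × n`
block `q`, different from `q` itself: a border of `q` along the TL/BR diagonal. -/
def IsBorderTLBR (m n u v : ℕ) (q : ℤ → ℤ → A) : Prop :=
  0 < u ∧ u ≤ m ∧ 0 < v ∧ v ≤ n ∧ ¬(u = m ∧ v = n) ∧
    ∀ i j : ℤ, 0 ≤ i → i < (u : ℤ) → 0 ≤ j → j < (v : ℤ) →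
      q i ((n : ℤ) - (v : ℤ) + j) = q ((m : ℤ) - (u : ℤ) + i) j

/-- Condition (*): `q` has two borders occurring in (horizontally or vertically)
adjacent corners of `q`, such that these two corner occurrences are neighbouring
fragments.  Since both fragments are restrictions of `q`, they automatically agree
on the intersection of their domains, and the union of the two corner rectangles is
simply connected exactly when they touch or overlap.  A border occurrence at the
top-left corner comes from a TL/BR border `b₁` (sizes `u₁ × v₁`), one at the
vertically adjacent bottom-left corner from a BL/TR border `b₂` (sizes `u₂ × v₂`),
and the two corner rectangles touch or overlap iff `v₁ + v₂ ≥ n`; horizontally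
adjacent corners likewise give `u₁ + u₂ ≥ m`, and the remaining two pairs of
adjacent corners give the same two conditions by symmetry. -/
def StarCond (m n : ℕ) (q : ℤ → ℤ → A) : Prop :=
  ∃ u₁ v₁ u₂ v₂ : ℕ, IsBorderTLBR m n u₁ v₁ q ∧ IsBorderBLTR m n u₂ v₂ q ∧
    (n ≤ v₁ + v₂ ∨ m ≤ u₁ + u₂)

/-- The `u × v` block `q (· % u) (· % v)` is a root of the `m × n` block `q`:
`q` is the concatenation of an `(m/u) × (n/v)` array of copies of it. -/
def IsRoot (m n u v : ℕ) (q : ℤ → ℤ → A) : Prop :=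
  0 < u ∧ 0 < v ∧ u ∣ m ∧ v ∣ n ∧
    ∀ i j : ℤ, 0 ≤ i → i < (m : ℤ) → 0 ≤ j → j < (n : ℤ) →
      q i j = q (i % (u : ℤ)) (j % (v : ℤ))

/-- The `m × n` block `q` is primitive: its only root is itself. -/
def Primitive (m n : ℕ) (q : ℤ → ℤ → A) : Prop :=
  ∀ u v : ℕ, IsRoot m n u v q → u = m ∧ v = n

/-- `(x, y)` is the position of the topmost among the rightmost occurrences of `q`
covering the position `(p₁, p₂)` in `w`. -/
def IsRho (m n : ℕ) (q w : ℤ → ℤ → A) (p₁ p₂ x y : ℤ) : Prop :=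
  CoversPos m n q w x y p₁ p₂ ∧
    (∀ x' y' : ℤ, CoversPos m n q w x' y' p₁ p₂ → x' ≤ x) ∧
    (∀ y' : ℤ, CoversPos m n q w x y' p₁ p₂ → y' ≤ y)

/-- `L_{k,k}(X)`: the set of `k × k` blocks occurring in configurations of `X`. -/
def LangSq (X : Set (ℤ → ℤ → A)) (k : ℕ) : Set (Fin k → Fin k → A) :=
  {b | ∃ w ∈ X, ∃ x y : ℤ, ∀ i j : Fin k, w (x + (i : ℤ)) (y + (j : ℤ)) = b i j}

/-- Topological entropy `h(X) = lim_{k→∞} log₂ |L_{k,k}(X)| / k²` (this limit always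
exists, hence coincides with the limsup used here). -/
noncomputable def entropy2D (X : Set (ℤ → ℤ → A)) : ℝ :=
  Filter.atTop.limsup fun k : ℕ => Real.logb 2 (Nat.card (LangSq X k)) / (k : ℝ) ^ 2

/-- The pattern with domain `D` and colors `p` occurs (up to translation) in `w`. -/
def PatternOccursIn (D : Finset (ℤ × ℤ)) (p : ℤ × ℤ → A) (w : ℤ → ℤ → A) : Prop :=
  ∃ t : ℤ × ℤ, ∀ d ∈ D, w (t.1 + d.1) (t.2 + d.2) = p d

/-- The `m × n` block `q` occurs at `(x, y)` inside the pattern with domain `D` and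
colors `p`: the whole occurrence lies in `D`. -/
def PatchOccursAt (m n : ℕ) (q : ℤ → ℤ → A) (D : Finset (ℤ × ℤ)) (p : ℤ × ℤ → A)
    (x y : ℤ) : Prop :=
  ∀ i j : ℤ, 0 ≤ i → i < (m : ℤ) → 0 ≤ j → j < (n : ℤ) →
    (x + i, y + j) ∈ D ∧ p (x + i, y + j) = q i j

/-- The pattern with domain `D` and colors `p` is `q`-coverable (a `q`-patch):
every position of `D` is covered by an occurrence of `q` inside the pattern. -/
def IsPatch (m n : ℕ) (q : ℤ → ℤ → A) (D : Finset (ℤ × ℤ)) (p : ℤ × ℤ → A) : Prop :=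
  ∀ d ∈ D, ∃ x y : ℤ, PatchOccursAt m n q D p x y ∧
    x ≤ d.1 ∧ d.1 < x + (m : ℤ) ∧ y ≤ d.2 ∧ d.2 < y + (n : ℤ)

/-- An interchangeable pair for `q`: two distinct `q`-patches with the same domain. -/
def InterchangeablePair (m n : ℕ) (q : ℤ → ℤ → A) (D : Finset (ℤ × ℤ))
    (p₁ p₂ : ℤ × ℤ → A) : Prop :=
  IsPatch m n q D p₁ ∧ IsPatch m n q D p₂ ∧ ∃ d ∈ D, p₁ d ≠ p₂ d

/-- `p` lies in the `k × l` rectangle with bottom-left corner `c`. -/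
def InRect (c : ℤ × ℤ) (k l : ℕ) (p : ℤ × ℤ) : Prop :=
  c.1 ≤ p.1 ∧ p.1 < c.1 + (k : ℤ) ∧ c.2 ≤ p.2 ∧ p.2 < c.2 + (l : ℤ)

/-- The pattern with domain `D` and colors `p` occurs in the restriction of `w` to
the `k × l` rectangle with bottom-left corner `c`. -/
def PatternOccursInRect (D : Finset (ℤ × ℤ)) (p : ℤ × ℤ → A) (w : ℤ → ℤ → A)
    (c : ℤ × ℤ) (k l : ℕ) : Prop :=
  ∃ t : ℤ × ℤ, ∀ d ∈ D,
    InRect c k l (t.1 + d.1, t.2 + d.2) ∧ w (t.1 + d.1) (t.2 + d.2) = p d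

/-- The combinatorial properties of the set `O` of positions of the occurrences of a block
violating condition (*) in a coverable configuration: the `m × n` rectangles cover the plane,
overlapping rectangles are never horizontally or vertically aligned, and the offsets of
overlaps along the two diagonals are jointly large. -/
structure GoodCover (m n : ℤ) (O : ℤ → ℤ → Prop) : Prop where
  cover : ∀ p r, ∃ x y, O x y ∧ x ≤ p ∧ p < x + m ∧ y ≤ r ∧ r < y + n
  vert : ∀ x y y', O x y → O x y' → y < y' → y + n ≤ y'
  horiz : ∀ x x' y, O x y → O x' y → x < x' → x + m ≤ x'
  cross : ∀ x₁ y₁ x₂ y₂ x₃ y₃ x₄ y₄, O x₁ y₁ → O x₂ y₂ → O x₃ y₃ → O x₄ y₄ →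
    x₁ < x₂ → x₂ < x₁ + m → y₁ < y₂ → y₂ < y₁ + n →
    x₃ < x₄ → x₄ < x₃ + m → y₄ < y₃ → y₃ < y₄ + n →
    m < (x₂ - x₁) + (x₄ - x₃) ∧ n < (y₂ - y₁) + (y₃ - y₄)

/-- Two overlapping rectangles have offset `(d, e)` with `d, e > 0`. -/
def HasOverlapNE (m n : ℤ) (O : ℤ → ℤ → Prop) (d : ℤ) : Prop :=
  ∃ x y y', O x y ∧ O (x + d) y' ∧ 0 < d ∧ d < m ∧ y < y' ∧ y' < y + n

/-- No two distinct rectangles overlap with an offset `(d, e)` with `d, e ≥ 0`. -/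
def SepNE (m n : ℤ) (O : ℤ → ℤ → Prop) : Prop :=
  ∀ x y x' y', O x y → O x' y' → x ≤ x' → x' < x + m → y ≤ y' → y' < y + n → x = x' ∧ y = y'

/-- No two distinct rectangles overlap with an offset `(d, -e)` with `d, e ≥ 0`. -/
def SepSE (m n : ℤ) (O : ℤ → ℤ → Prop) : Prop :=
  ∀ x y x' y', O x y → O x' y' → x ≤ x' → x' < x + m → y' ≤ y → y < y' + n → x = x' ∧ y = y'

namespace GoodCover

variable {m n : ℤ} {O : ℤ → ℤ → Prop}

lemma rotate_half (h : GoodCover m n O) : GoodCover m n fun x y => O (-x) (-y) where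
  cover p r := by
    obtain ⟨x, y, hO, h1, h2, h3, h4⟩ := h.cover (-p + m - 1) (-r + n - 1)
    exact ⟨-x, -y, by simpa using hO, by omega, by omega, by omega, by omega⟩
  vert x y y' h1 h2 h3 := by have := h.vert _ _ _ h2 h1 (by omega); omega
  horiz x x' y h1 h2 h3 := by have := h.horiz _ _ _ h2 h1 (by omega); omega
  cross x₁ y₁ x₂ y₂ x₃ y₃ x₄ y₄ h₁ h₂ h₃ h₄ a b c d e f g i := by
    have := h.cross _ _ _ _ _ _ _ _ h₂ h₁ h₄ h₃ (by omega) (by omega) (by omega) (by omega)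
      (by omega) (by omega) (by omega) (by omega)
    omega

lemma rotate_quarter (h : GoodCover m n O) : GoodCover n m fun x y => O y (-x) where
  cover p r := by
    obtain ⟨x, y, hO, h1, h2, h3, h4⟩ := h.cover r (-p + n - 1)
    exact ⟨-y, x, by simpa using hO, by omega, by omega, by omega, by omega⟩
  vert x y y' h1 h2 h3 := h.horiz _ _ _ h1 h2 h3
  horiz x x' y h1 h2 h3 := by have := h.vert _ _ _ h2 h1 (by omega); omega
  cross x₁ y₁ x₂ y₂ x₃ y₃ x₄ y₄ h₁ h₂ h₃ h₄ a b c d e f g i := by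
    have := h.cross _ _ _ _ _ _ _ _ h₄ h₃ h₁ h₂ (by omega) (by omega) (by omega) (by omega)
      (by omega) (by omega) (by omega) (by omega)
    omega

/-- An overlap with minimal horizontal offset `d` propagates to the right: it is the start of
a seam along which the rectangle below and the rectangle above are shifted by `d`. -/
lemma seam_right (h : GoodCover m n O) {d : ℤ} (hd : HasOverlapNE m n O d)
    (hmin : ∀ d', HasOverlapNE m n O d' → d ≤ d') {x y b : ℤ} (hA : O x y)
    (hB : O (x + d) (y + b)) (hb : 0 < b) (hbn : b ≤ n) :
    O (x + m) (y + b - n) ∧ ∃ b', 0 < b' ∧ b' ≤ n ∧ O (x + m + d) (y + b - n + b') := by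
  obtain ⟨x₀, y₀, y₁, hP, hQ, hd0, hdm, hy1, hy2⟩ := hd
  have key : ∀ x' y' x'' y'', O x' y' → O x'' y'' → x' < x'' → x'' < x' + m → y'' < y' →
      y' < y'' + n → m < d + (x'' - x') := by
    intro x' y' x'' y'' h1 h2 h3 h4 h5 h6
    have := (h.cross _ _ _ _ _ _ _ _ hP hQ h1 h2 (by omega) (by omega) (by omega) (by omega)
      h3 h4 h5 h6).1
    omega
  have hmin' : ∀ x' y' x'' y'', O x' y' → O x'' y'' → x' < x'' → x'' < x' + m → y' < y'' →
      y'' < y' + n → d ≤ x'' - x' := by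
    intro x' y' x'' y'' h1 h2 h3 h4 h5 h6
    exact hmin _ ⟨x', y', y'', h1, by simpa using h2, by omega, by omega, by omega, by omega⟩
  have hA' : O (x + m) (y + b - n) := by
    obtain ⟨u, v, hH, h1, h2, h3, h4⟩ := h.cover (x + m) (y + b - 1)
    have hv : v = y + b - n := by
      by_contra hne
      rcases lt_trichotomy u (x + d) with hu | hu | hu
      · have := h.horiz x u v
        rcases lt_trichotomy v y with hv | hv | hv
        · have := (h.cross _ _ _ _ _ _ _ _ hH hB hA hH (by omega) (by omega) (by omega) (by omega)
            (by omega) (by omega) (by omega) (by omega)).1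
          omega
        · subst hv
          have := this hA hH (by omega)
          omega
        · have := hmin' _ _ _ _ hA hH (by omega) (by omega) (by omega) (by omega)
          omega
      · subst hu
        have := h.vert _ _ _ hH hB (by omega)
        omega
      · have := key _ _ _ _ hB hH (by omega) (by omega) (by omega) (by omega)
        omega
    have hu : u = x + m := by
      by_contra hne
      rcases hbn.lt_or_eq with hb' | hb'
      · have := (h.cross _ _ _ _ _ _ _ _ hA hB hA hH (by omega) (by omega) (by omega) (by omega)
            (by omega) (by omega) (by omega) (by omega)).2
        omega
      · have hvy : v = y := by omega
        subst hvy
        have := h.horiz _ _ _ hA hH (by omega)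
        omega
    rwa [← hv, ← hu]
  refine ⟨hA', ?_⟩
  obtain ⟨u, v, hK, h1, h2, h3, h4⟩ := h.cover (x + d + m) (y + b)
  have hu : u = x + m + d := by
    by_contra hne
    rcases h3.lt_or_eq with hv | hv
    · have h5 := key _ _ _ _ hB hK (by omega) (by omega) (by omega) (by omega)
      have := (h.cross _ _ _ _ _ _ _ _ hA' hK hB hK (by omega) (by omega) (by omega) (by omega)
            (by omega) (by omega) (by omega) (by omega)).2
      omega
    · subst hv
      have := h.horiz _ _ _ hB hK (by omega)
      omega
  refine ⟨v - (y + b - n), by omega, by omega, ?_⟩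
  rw [← hu]
  simpa using hK

lemma seam_left (h : GoodCover m n O) {d : ℤ} (hd : HasOverlapNE m n O d)
    (hmin : ∀ d', HasOverlapNE m n O d' → d ≤ d') {x y b : ℤ} (hA : O x y)
    (hB : O (x + d) (y + b)) (hb : 0 < b) (hbn : b ≤ n) :
    ∃ b', 0 < b' ∧ b' ≤ n ∧ O (x - m) (y + n - b') ∧ O (x - m + d) (y + n) := by
  have flip : ∀ d', HasOverlapNE m n O d' ↔ HasOverlapNE m n (fun x y => O (-x) (-y)) d' := by
    intro d'
    constructor
    · rintro ⟨x, y, y', h1, h2, h3, h4, h5, h6⟩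
      exact ⟨-(x + d'), -y', -y, by simpa using h2, by simpa using h1, h3, h4,
        by omega, by omega⟩
    · rintro ⟨x, y, y', h1, h2, h3, h4, h5, h6⟩
      refine ⟨-(x + d'), -y', -y, h2, ?_, h3, h4, by omega, by omega⟩
      convert h1 using 1
      ring
  obtain ⟨h1, b', h2, h3, h4⟩ := h.rotate_half.seam_right (x := -(x + d)) (y := -(y + b)) (b := b)
    ((flip d).1 hd) (fun d' hd' => hmin d' ((flip d').2 hd')) (by simpa using hB)
    (by simpa using hA) hb hbn
  refine ⟨b', h2, h3, ?_, ?_⟩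
  · convert h4 using 1 <;> ring
  · convert h1 using 1 <;> ring

end GoodCover

/-- A descending horizontal path of rectangles meets an ascending vertical one. -/
lemma exists_meeting {m n : ℤ} (hm : 0 < m) {H V : ℤ → ℤ → Prop}
    (hR : ∀ x y, H x y → ∃ s, 0 ≤ s ∧ s < n ∧ H (x + m) (y - s))
    (hL : ∀ x y, H x y → ∃ s, 0 ≤ s ∧ s < n ∧ H (x - m) (y + s))
    (hU : ∀ x y, V x y → ∃ s, 0 ≤ s ∧ s < m ∧ V (x + s) (y + n))
    (hD : ∀ x y, V x y → ∃ s, 0 ≤ s ∧ s < m ∧ V (x - s) (y - n))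
    (hH : ∃ x y, H x y) (hV : ∃ x y, V x y) :
    ∃ x y x' y', H x y ∧ V x' y' ∧ x ≤ x' ∧ x' < x + m ∧ y' < y + n ∧ y < y' + n := by
  obtain ⟨x₀, y₀, h₀⟩ := hH
  obtain ⟨u, v, huv⟩ := hV
  have walk : ∀ t : ℤ, ∃ y, H (x₀ + t * m) y := by
    intro t
    induction t using Int.induction_on with
    | zero => exact ⟨y₀, by simpa using h₀⟩
    | succ i ih =>
      obtain ⟨y, hy⟩ := ih
      obtain ⟨s, -, -, hs⟩ := hR _ _ hy
      exact ⟨_, by convert hs using 1; ring⟩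
    | pred i ih =>
      obtain ⟨y, hy⟩ := ih
      obtain ⟨s, -, -, hs⟩ := hL _ _ hy
      exact ⟨_, by convert hs using 1; ring⟩
  obtain ⟨y₁, hy₁⟩ := walk ((u - x₀) / m)
  have e1 := Int.emod_add_mul_ediv (u - x₀) m
  have e2 := Int.emod_nonneg (u - x₀) hm.ne'
  have e3 := Int.emod_lt_of_pos (u - x₀) hm
  rw [mul_comm] at e1
  have main : ∀ N : ℕ, ∀ x y x' y', H x y → V x' y' → x ≤ x' → x' < x + m →
      (y' - y).natAbs ≤ N →
      ∃ x y x' y', H x y ∧ V x' y' ∧ x ≤ x' ∧ x' < x + m ∧ y' < y + n ∧ y < y' + n := by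
    intro N
    induction N with
    | zero =>
      intro x y x' y' h1 h2 h3 h4 h5
      obtain ⟨s, _, _, _⟩ := hR _ _ h1
      exact ⟨x, y, x', y', h1, h2, h3, h4, by omega, by omega⟩
    | succ N ih =>
      intro x y x' y' h1 h2 h3 h4 h5
      obtain ⟨s₀, _, _, _⟩ := hR _ _ h1
      by_cases c1 : y' < y + n
      · by_cases c2 : y < y' + n
        · exact ⟨x, y, x', y', h1, h2, h3, h4, c1, c2⟩
        · obtain ⟨s, hs0, hsm, hs⟩ := hU _ _ h2
          by_cases c3 : x' + s < x + m
          · exact ih _ _ _ _ h1 hs (by omega) c3 (by omega)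
          · obtain ⟨t, ht0, htn, ht⟩ := hR _ _ h1
            by_cases c4 : y - t < y' + n + n
            · exact ⟨_, _, _, _, ht, hs, by omega, by omega, by omega, by omega⟩
            · exact ih _ _ _ _ ht hs (by omega) (by omega) (by omega)
      · obtain ⟨s, hs0, hsm, hs⟩ := hD _ _ h2
        by_cases c3 : x ≤ x' - s
        · exact ih _ _ _ _ h1 hs c3 (by omega) (by omega)
        · obtain ⟨t, ht0, htn, ht⟩ := hL _ _ h1
          by_cases c4 : y' - n < y + t + n
          · exact ⟨_, _, _, _, ht, hs, by omega, by omega, by omega, by omega⟩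
          · exact ih _ _ _ _ ht hs (by omega) (by omega) (by omega)
  exact main _ _ _ _ _ hy₁ huv (by omega) (by omega) le_rfl

lemma exists_minimal_overlapNE {m n : ℤ} {O : ℤ → ℤ → Prop} (h : ∃ d, HasOverlapNE m n O d) :
    ∃ d, HasOverlapNE m n O d ∧ ∀ d', HasOverlapNE m n O d' → d ≤ d' :=
  Int.exists_least_of_bdd ⟨0, fun _ ⟨_, _, _, _, _, h3, _⟩ => h3.le⟩ h

namespace GoodCover

variable {m n : ℤ} {O : ℤ → ℤ → Prop}

/-- Overlaps along the two diagonals cannot coexist. -/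
lemma not_both_overlaps (h : GoodCover m n O) (hp : ∃ d, HasOverlapNE m n O d)
    (hq : ∃ e, HasOverlapNE n m (fun x y => O y (-x)) e) : False := by
  obtain ⟨d, hd, hdmin⟩ := exists_minimal_overlapNE hp
  obtain ⟨e, he, hemin⟩ := exists_minimal_overlapNE hq
  have hr := h.rotate_quarter
  obtain ⟨x₀, y₀, y₁, hP, hQ, hd0, hdm, hy1, hy2⟩ := id hd
  obtain ⟨u₀, v₀, v₁, hP', hQ', he0, hen, hv1, hv2⟩ := id he
  obtain ⟨x, y, x', y', ⟨hA, b, hb, hbn, hB⟩, ⟨hC, c, hc, hcm, hD⟩, h1, h2, h3, h4⟩ :=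
    exists_meeting (m := m) (n := n)
      (H := fun x y => O x y ∧ ∃ b, 0 < b ∧ b ≤ n ∧ O (x + d) (y + b))
      (V := fun x y => O x y ∧ ∃ c, 0 < c ∧ c ≤ m ∧ O (x + c) (y - e)) (by omega)
      (by
        rintro x y ⟨hA, b, hb, hbn, hB⟩
        obtain ⟨hA', b', hb', hbn', hB'⟩ := h.seam_right hd hdmin hA hB hb hbn
        refine ⟨n - b, by omega, by omega, ?_, b', hb', hbn', ?_⟩
        · convert hA' using 1; ring
        · convert hB' using 1; ring)
      (by
        rintro x y ⟨hA, b, hb, hbn, hB⟩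
        obtain ⟨b', hb', hbn', hA', hB'⟩ := h.seam_left hd hdmin hA hB hb hbn
        refine ⟨n - b', by omega, by omega, ?_, b', hb', hbn', ?_⟩
        · convert hA' using 1; ring
        · convert hB' using 1; ring)
      (by
        rintro x y ⟨hC, c, hc, hcm, hD⟩
        obtain ⟨c', hc', hcm', hC', hD'⟩ := hr.seam_left (x := -y) (y := x) he hemin
          (by simpa using hC) (by convert hD using 1; ring) hc hcm
        refine ⟨m - c', by omega, by omega, ?_, c', hc', hcm', ?_⟩
        · convert hC' using 1 <;> ring
        · convert hD' using 1 <;> ring)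
      (by
        rintro x y ⟨hC, c, hc, hcm, hD⟩
        obtain ⟨hC', c', hc', hcm', hD'⟩ := hr.seam_right (x := -y) (y := x) he hemin
          (by simpa using hC) (by convert hD using 1; ring) hc hcm
        refine ⟨m - c, by omega, by omega, ?_, c', hc', hcm', ?_⟩
        · convert hC' using 1 <;> ring
        · convert hD' using 1 <;> ring)
      ⟨x₀, y₀, hP, y₁ - y₀, by omega, by omega, by simpa using hQ⟩
      ⟨v₀, -u₀, hP', v₁ - v₀, by omega, by omega, by convert hQ' using 1 <;> ring⟩
  obtain ⟨hA', -⟩ := h.seam_right hd hdmin hA hB hb hbn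
  have hC' : O (x' + c - m) (y' - n) := by
    have := (hr.seam_right (x := -y') (y := x') he hemin
      (by simpa using hC) (by convert hD using 1; ring) hc hcm).1
    convert this using 1
    ring
  have hbe : n < b + e := by
    rcases hbn.lt_or_eq with hb' | hb'
    · have := (h.cross _ _ _ _ _ _ _ _ hA hB hP' hQ' (by omega) (by omega) (by omega) (by omega)
        (by omega) (by omega) (by omega) (by omega)).2
      omega
    · omega
  rcases h1.lt_or_eq with hx | hx
  · rcases lt_trichotomy y y' with hy | hy | hy
    · have hpc : 0 < x' - x + c - m := by
        rcases hcm.lt_or_eq with hc' | hc'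
        · have := (h.cross _ _ _ _ _ _ _ _ hA hC hC hD (by omega) (by omega) (by omega)
            (by omega) (by omega) (by omega) (by omega) (by omega)).1
          omega
        · omega
      have := (h.cross _ _ _ _ _ _ _ _ hA hC hA hC' (by omega) (by omega) (by omega)
            (by omega) (by omega) (by omega) (by omega) (by omega)).2
      omega
    · subst hy
      have := h.horiz _ _ _ hA hC hx
      omega
    · have hbr : n < b + (y - y') := by
        rcases hbn.lt_or_eq with hb' | hb'
        · have := (h.cross _ _ _ _ _ _ _ _ hA hB hA hC (by omega) (by omega) (by omega)
            (by omega) (by omega) (by omega) (by omega) (by omega)).2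
          omega
        · omega
      have := (h.cross _ _ _ _ _ _ _ _ hC hA' hA hC (by omega) (by omega) (by omega)
            (by omega) (by omega) (by omega) (by omega) (by omega)).1
      omega
  · subst hx
    have hy : y = y' := by
      rcases lt_trichotomy y y' with hy | hy | hy
      · have := h.vert _ _ _ hA hC hy
        omega
      · exact hy
      · have := h.vert _ _ _ hC hA hy
        omega
    subst hy
    rcases hcm.lt_or_eq with hc' | hc'
    · have := (h.cross _ _ _ _ _ _ _ _ hD hA' hC hD (by omega) (by omega) (by omega)
            (by omega) (by omega) (by omega) (by omega) (by omega)).1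
      omega
    · subst hc'
      have := h.vert _ _ _ hD hA' (by omega)
      omega

lemma sepNE_or_sepSE (h : GoodCover m n O) : SepNE m n O ∨ SepSE m n O := by
  by_contra hcon
  simp only [not_or, SepNE, SepSE] at hcon
  push Not at hcon
  obtain ⟨⟨x, y, x', y', h1, h2, h3, h4, h5, h6, h7⟩,
    ⟨u, v, u', v', g1, g2, g3, g4, g5, g6, g7⟩⟩ := hcon
  have hx : x < x' := by
    refine lt_of_le_of_ne h3 fun hx => ?_
    subst hx
    have := h.vert _ _ _ h1 h2 (lt_of_le_of_ne h5 (h7 rfl))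
    omega
  have hy : y < y' := by
    refine lt_of_le_of_ne h5 fun hy => ?_
    subst hy
    have := h.horiz _ _ _ h1 h2 hx
    omega
  have hu : u < u' := by
    refine lt_of_le_of_ne g3 fun hx => ?_
    subst hx
    have := h.vert _ _ _ g2 g1 (lt_of_le_of_ne g5 (Ne.symm (g7 rfl)))
    omega
  have hv : v' < v := by
    refine lt_of_le_of_ne g5 fun hy => ?_
    subst hy
    have := h.horiz _ _ _ g1 g2 hu
    omega
  refine h.not_both_overlaps ⟨x' - x, x, y, y', h1, by simpa using h2, by omega, by omega, hy, h6⟩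
    ⟨v - v', -v, u, u', by simpa using g1, ?_, by omega, by omega, hu, g4⟩
  convert g2 using 1
  ring

end GoodCover

lemma OccursAt.isBorderBLTR {m n : ℕ} {q w : ℤ → ℤ → A} {x y x' y' : ℤ}
    (h : OccursAt m n q w x y) (h' : OccursAt m n q w x' y') (hx : x ≤ x') (hxm : x' < x + m)
    (hy : y ≤ y') (hyn : y' < y + n) (hne : x < x' ∨ y < y') :
    IsBorderBLTR m n (m - (x' - x)).toNat (n - (y' - y)).toNat q := by
  refine ⟨by omega, by omega, by omega, by omega, by omega, fun i j hi hi' hj hj' => ?_⟩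
  rw [← h' i j hi (by omega) hj (by omega), ← h _ _ (by omega) (by omega) (by omega) (by omega)]
  congr 1 <;> omega

lemma OccursAt.isBorderTLBR {m n : ℕ} {q w : ℤ → ℤ → A} {x y x' y' : ℤ}
    (h : OccursAt m n q w x y) (h' : OccursAt m n q w x' y') (hx : x ≤ x') (hxm : x' < x + m)
    (hy : y' ≤ y) (hyn : y < y' + n) (hne : x < x' ∨ y' < y) :
    IsBorderTLBR m n (m - (x' - x)).toNat (n - (y - y')).toNat q := by
  refine ⟨by omega, by omega, by omega, by omega, by omega, fun i j hi hi' hj hj' => ?_⟩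
  rw [← h' i _ hi (by omega) (by omega) (by omega), ← h _ j (by omega) (by omega) hj (by omega)]
  congr 1 <;> omega

lemma goodCover_of_not_starCond {m n : ℕ} {q w : ℤ → ℤ → A} (hstar : ¬ StarCond m n q)
    (hw : Coverable m n q w) : GoodCover m n (OccursAt m n q w) where
  cover := hw
  vert x y y' h h' hlt := by
    by_contra hcon
    have h0 := hw 0 0
    obtain ⟨_, _, _, _, _, _⟩ := h0
    exact hstar ⟨_, _, _, _, h'.isBorderTLBR h le_rfl (by omega) hlt.le (by omega) (.inr hlt),
      h.isBorderBLTR h' le_rfl (by omega) hlt.le (by omega) (.inr hlt), by omega⟩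
  horiz x x' y h h' hlt := by
    by_contra hcon
    have h0 := hw 0 0
    obtain ⟨_, _, _, _, _, _⟩ := h0
    exact hstar ⟨_, _, _, _, h.isBorderTLBR h' hlt.le (by omega) le_rfl (by omega) (.inl hlt),
      h.isBorderBLTR h' hlt.le (by omega) le_rfl (by omega) (.inl hlt), by omega⟩
  cross x₁ y₁ x₂ y₂ x₃ y₃ x₄ y₄ h₁ h₂ h₃ h₄ _ _ _ _ _ _ _ _ := by
    by_contra hcon
    exact hstar ⟨_, _, _, _,
      h₃.isBorderTLBR h₄ (by omega) (by omega) (by omega) (by omega) (by omega),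
      h₁.isBorderBLTR h₂ (by omega) (by omega) (by omega) (by omega) (by omega), by omega⟩

/-- The `m × n` rectangle at `t` contains the cell `(x, y)`. -/
def RectContains (m n : ℤ) (t : ℤ × ℤ) (x y : ℤ) : Prop :=
  t.1 ≤ x ∧ x < t.1 + m ∧ t.2 ≤ y ∧ y < t.2 + n

open Classical in
/-- The rightmost rectangle containing `(x, y)`, computed from the rightmost rectangles
`l` and `b` containing `(x - 1, y)` and `(x, y - 1)`. -/
noncomputable def nextRect (m n : ℤ) (x y : ℤ) (l b : ℤ × ℤ) : ℤ × ℤ :=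
  if RectContains m n b x y then b else if RectContains m n l x y then l else (x, y)

/-- `t` is the position of a rightmost rectangle of `O` containing `(x, y)`. -/
def IsRightmost (m n : ℤ) (O : ℤ → ℤ → Prop) (x y : ℤ) (t : ℤ × ℤ) : Prop :=
  O t.1 t.2 ∧ RectContains m n t x y ∧
    ∀ s : ℤ × ℤ, O s.1 s.2 → RectContains m n s x y → s.1 ≤ t.1

lemma exists_isRightmost {m n : ℤ} {O : ℤ → ℤ → Prop} {x y : ℤ}
    (h : ∃ u v, O u v ∧ u ≤ x ∧ x < u + m ∧ v ≤ y ∧ y < v + n) :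
    ∃ t, IsRightmost m n O x y t := by
  obtain ⟨u, v, h1, h2⟩ := h
  obtain ⟨a, ⟨c, hc, hc'⟩, ha⟩ := Int.exists_greatest_of_bdd
    (P := fun a => ∃ c, O a c ∧ RectContains m n (a, c) x y)
    ⟨x, fun a ⟨_, _, h⟩ => h.1⟩ ⟨u, v, h1, h2⟩
  exact ⟨(a, c), hc, hc', fun s hs hs' => ha _ ⟨s.2, hs, hs'⟩⟩

lemma SepNE.eq_nextRect {m n : ℤ} {O : ℤ → ℤ → Prop} (hO : SepNE m n O) {x y : ℤ}
    {l b t : ℤ × ℤ} (hl : IsRightmost m n O (x - 1) y l) (hb : IsRightmost m n O x (y - 1) b)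
    (ht : IsRightmost m n O x y t) : t = nextRect m n x y l b := by
  obtain ⟨l1, l2⟩ := l
  obtain ⟨b1, b2⟩ := b
  obtain ⟨t1, t2⟩ := t
  obtain ⟨hl1, hl2, hl3⟩ := hl
  obtain ⟨hb1, hb2, hb3⟩ := hb
  obtain ⟨ht1, ht2, ht3⟩ := ht
  have e1 := hl3 _ ht1
  have e2 := hb3 _ ht1
  have e3 := ht3 _ hb1
  have e4 := ht3 _ hl1
  have s1 := hO _ _ _ _ hb1 ht1
  have s2 := hO _ _ _ _ ht1 hb1
  have s3 := hO _ _ _ _ hl1 ht1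
  have s4 := hO _ _ _ _ ht1 hl1
  clear hl3 hb3 ht3 hO
  unfold nextRect
  split_ifs <;> rw [Prod.mk.injEq] <;> simp only [RectContains] at * <;> omega

/-- The `k × k` blocks of coverable configurations whose occurrences of `q` satisfy `P`. -/
def LangWith (m n : ℕ) (q : ℤ → ℤ → A) (P : (ℤ → ℤ → Prop) → Prop) (k : ℕ) :
    Set (Fin k → Fin k → A) :=
  LangSq {w | Coverable m n q w ∧ P (OccursAt m n q w)} k

lemma exists_rects_of_mem_langWith {m n k : ℕ} {q : ℤ → ℤ → A} {c : Fin k → Fin k → A}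
    (hc : c ∈ LangWith m n q (SepNE m n) k) :
    ∃ N : ℕ → ℕ → ℤ × ℤ, (∀ i j, RectContains m n (N i j) i j) ∧
      (∀ i j, N (i + 1) (j + 1) =
        nextRect m n ((i + 1 : ℕ) : ℤ) ((j + 1 : ℕ) : ℤ) (N i (j + 1)) (N (i + 1) j)) ∧
      ∀ i j : Fin k, c i j = q (i - (N i j).1) (j - (N i j).2) := by
  obtain ⟨w, ⟨hw, hsep⟩, x, y, hxy⟩ := hc
  have hsep' : SepNE m n fun u v => OccursAt m n q w (x + u) (y + v) := by
    intro u v u' v' h1 h2 h3 h4 h5 h6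
    have := hsep _ _ _ _ h1 h2 (by omega) (by omega) (by omega) (by omega)
    omega
  have hex : ∀ i j : ℕ,
      ∃ t, IsRightmost m n (fun u v => OccursAt m n q w (x + u) (y + v)) i j t := by
    intro i j
    obtain ⟨u, v, h1, h2, h3, h4, h5⟩ := hw (x + i) (y + j)
    exact exists_isRightmost
      ⟨u - x, v - y, by simpa using h1, by omega, by omega, by omega, by omega⟩
  choose N hN using hex
  refine ⟨N, fun i j => (hN i j).2.1, fun i j => ?_, fun i j => ?_⟩
  · refine hsep'.eq_nextRect ?_ ?_ (hN _ _)
    · simpa using hN i (j + 1)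
    · simpa using hN (i + 1) j
  · obtain ⟨h1, ⟨h2, h3, h4, h5⟩, -⟩ := hN i j
    rw [← hxy, ← h1 _ _ (by omega) (by omega) (by omega) (by omega)]
    congr 1 <;> omega

lemma ncard_langWith_sepNE_le [Finite A] {m n : ℕ} (q : ℤ → ℤ → A) (k : ℕ) :
    (LangWith m n q (SepNE m n) k).ncard ≤ (m * n) ^ (2 * k) := by
  choose! N hcov hstep hval using
    fun c (hc : c ∈ LangWith m n q (SepNE m n) k) => exists_rects_of_mem_langWith hc
  let cell : Fin k ⊕ Fin k → ℕ × ℕ := Sum.elim (fun i => (i, 0)) (fun j => (0, j))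
  let D : LangWith m n q (SepNE m n) k → (Fin k ⊕ Fin k → Fin m × Fin n) := fun c s =>
    have h := hcov c c.2 (cell s).1 (cell s).2
    (⟨((cell s).1 - (N c (cell s).1 (cell s).2).1).toNat, by
        obtain ⟨_, _, _, _⟩ := h
        omega⟩,
      ⟨((cell s).2 - (N c (cell s).1 (cell s).2).2).toNat, by
        obtain ⟨_, _, _, _⟩ := h
        omega⟩)
  have hD : Function.Injective D := by
    intro c c' hcc
    have hcell : ∀ s, N c (cell s).1 (cell s).2 = N c' (cell s).1 (cell s).2 := by
      intro s
      have h1 := congrFun hcc s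
      obtain ⟨_, _, _, _⟩ := hcov c c.2 (cell s).1 (cell s).2
      obtain ⟨_, _, _, _⟩ := hcov c' c'.2 (cell s).1 (cell s).2
      simp only [D, Prod.mk.injEq, Fin.mk.injEq] at h1
      ext <;> omega
    have hleft : ∀ j < k, N c 0 j = N c' 0 j := fun j hj => hcell (.inr ⟨j, hj⟩)
    have hbottom : ∀ i < k, N c i 0 = N c' i 0 := fun i hi => hcell (.inl ⟨i, hi⟩)
    have hall : ∀ i < k, ∀ j < k, N c i j = N c' i j := by
      intro i
      induction i with
      | zero => exact fun _ => hleft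
      | succ i ihi =>
        intro hi j
        induction j with
        | zero => exact fun _ => hbottom _ hi
        | succ j ihj =>
          intro hj
          rw [hstep c c.2, hstep c' c'.2, ihi (by omega) _ hj, ihj (by omega)]
    ext i j
    rw [hval c c.2, hval c' c'.2, hall i i.2 j j.2]
  have := Nat.card_le_card_of_injective D hD
  simpa [Nat.card_coe_set_eq, Nat.card_eq_fintype_card, ← two_mul] using this

lemma occursAt_reflect {m n : ℕ} {q w : ℤ → ℤ → A} {x y : ℤ} :
    OccursAt m n (fun i j => q (m - 1 - i) j) (fun u v => w (-u) v) x y ↔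
      OccursAt m n q w (1 - m - x) y := by
  constructor
  · intro h i j hi hi' hj hj'
    convert h (m - 1 - i) j (by omega) (by omega) hj hj' using 2 <;> ring
  · intro h i j hi hi' hj hj'
    convert h (m - 1 - i) j (by omega) (by omega) hj hj' using 2
    ring

lemma ncard_langWith_sepSE_le [Finite A] {m n : ℕ} (q : ℤ → ℤ → A) (k : ℕ) :
    (LangWith m n q (SepSE m n) k).ncard ≤ (m * n) ^ (2 * k) := by
  refine le_trans (Set.ncard_le_ncard_of_injOn (fun c i j => c i.rev j) ?_ ?_ (Set.toFinite _))
    (ncard_langWith_sepNE_le (fun i j => q (m - 1 - i) j) k)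
  · rintro c ⟨w, ⟨hw, hsep⟩, x, y, hxy⟩
    refine ⟨fun u v => w (-u) v, ⟨fun p r => ?_, ?_⟩, -(x + k - 1), y, fun i j => ?_⟩
    · obtain ⟨u, v, h1, h2, h3, h4, h5⟩ := hw (-p) r
      refine ⟨1 - m - u, v, ?_, by omega, by omega, h4, h5⟩
      rw [occursAt_reflect]
      simpa using h1
    · intro u v u' v' h1 h2 h3 h4 h5 h6
      rw [occursAt_reflect] at h1 h2
      have := hsep _ _ _ _ h2 h1 (by omega) (by omega) (by omega) (by omega)
      omega
    · change w (-(-(x + k - 1) + i)) (y + j) = c i.rev j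
      rw [← hxy]
      congr 1
      rw [Fin.val_rev]
      omega
  · intro c _ c' _ h
    ext i j
    simpa using congrFun (congrFun h i.rev) j

/-- if the primitive `m × n` block `q` does not satisfy condition (*),
then for every `k ≥ 1` we have `|L_{k,k}(X_q)| ≤ (2k+1)² · (mn)^(2k+1)`. -/
theorem card_langSq_le {A : Type*} [Fintype A] (m n : ℕ) (hm : 0 < m) (hn : 0 < n)
    (q : ℤ → ℤ → A) (hq : Primitive m n q) (hstar : ¬ StarCond m n q)
    (k : ℕ) (hk : 1 ≤ k) :
    Nat.card (LangSq (Xq m n q) k) ≤ (2 * k + 1) ^ 2 * (m * n) ^ (2 * k + 1) := by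
  have hsub : LangSq (Xq m n q) k ⊆
      LangWith m n q (SepNE m n) k ∪ LangWith m n q (SepSE m n) k := by
    rintro c ⟨w, hw, hc⟩
    rcases (goodCover_of_not_starCond hstar hw).sepNE_or_sepSE with h | h
    · exact .inl ⟨w, ⟨hw, h⟩, hc⟩
    · exact .inr ⟨w, ⟨hw, h⟩, hc⟩
  rw [Nat.card_coe_set_eq]
  calc (LangSq (Xq m n q) k).ncard
      ≤ (m * n) ^ (2 * k) + (m * n) ^ (2 * k) :=
        (Set.ncard_le_ncard hsub (Set.toFinite _)).trans <| (Set.ncard_union_le _ _).trans <|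
          add_le_add (ncard_langWith_sepNE_le q k) (ncard_langWith_sepSE_le q k)
    _ = 2 * (m * n) ^ (2 * k) := (two_mul _).symm
    _ ≤ (2 * k + 1) ^ 2 * (m * n) ^ (2 * k + 1) :=
        Nat.mul_le_mul (by nlinarith)
          (Nat.pow_le_pow_right (Nat.mul_pos hm hn) (Nat.le_succ _))
end

section
/- Let q be a primitive block. If the subshift X_q of q-coverable configurations has strictly positive topological entropy, then there exists an interchangeable pair for q. -/
open Filter

variable {A : Type*}

/-- Shifting a coverable configuration keeps it coverable. -/
theorem Coverable.shift {m n : ℕ} {q w : ℤ → ℤ → A} (hw : Coverable m n q w) (a b : ℤ) :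
    Coverable m n q fun i j => w (a + i) (b + j) := by
  intro p₁ p₂
  obtain ⟨x, y, ho, h₁, h₂, h₃, h₄⟩ := hw (a + p₁) (b + p₂)
  refine ⟨x - a, y - b, fun i j hi hi' hj hj' => ?_, by omega, by omega, by omega, by omega⟩
  have h := ho i j hi hi' hj hj'
  dsimp only
  rwa [show a + (x - a + i) = x + i by ring, show b + (y - b + j) = y + j by ring]

/-- The square `[0, k)²`. -/
noncomputable def innerSquare (k : ℕ) : Finset (ℤ × ℤ) :=
  Finset.Ico 0 (k : ℤ) ×ˢ Finset.Ico 0 (k : ℤ)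

/-- The square `[0, k)²` enlarged by `m` to the left and right and by `n` up and down. -/
noncomputable def outerBox (m n k : ℕ) : Finset (ℤ × ℤ) :=
  Finset.Ico (-(m : ℤ)) (k + m) ×ˢ Finset.Ico (-(n : ℤ)) (k + n)

theorem innerSquare_subset_outerBox (m n k : ℕ) : innerSquare k ⊆ outerBox m n k := by
  rintro ⟨a, b⟩ h
  simp only [innerSquare, outerBox, Finset.mem_product, Finset.mem_Ico] at h ⊢
  omega

theorem card_outerBox_sdiff_innerSquare (m n k : ℕ) :
    (outerBox m n k \ innerSquare k).card = 2 * (m + n) * k + 4 * m * n := by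
  rw [Finset.card_sdiff_of_subset (innerSquare_subset_outerBox m n k), innerSquare, outerBox,
    Finset.card_product, Finset.card_product, Int.card_Ico, Int.card_Ico, Int.card_Ico,
    show ((k : ℤ) + m - -(m : ℤ)).toNat = k + 2 * m by omega,
    show ((k : ℤ) + n - -(n : ℤ)).toNat = k + 2 * n by omega,
    show ((k : ℤ) - 0).toNat = k by omega]
  apply Nat.sub_eq_of_eq_add
  ring

open Classical in
/-- The union of the occurrences of `q` in `w` that meet the square `[0, k)²`. -/
noncomputable def occurrenceHull (m n : ℕ) (q w : ℤ → ℤ → A) (k : ℕ) : Finset (ℤ × ℤ) :=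
  (outerBox m n k).filter fun d => ∃ x y : ℤ, CoversPos m n q w x y d.1 d.2 ∧
    ∃ c ∈ innerSquare k, CoversPos m n q w x y c.1 c.2

theorem mem_occurrenceHull {m n : ℕ} {q w : ℤ → ℤ → A} {k : ℕ} {d : ℤ × ℤ} :
    d ∈ occurrenceHull m n q w k ↔ d ∈ outerBox m n k ∧
      ∃ x y : ℤ, CoversPos m n q w x y d.1 d.2 ∧
        ∃ c ∈ innerSquare k, CoversPos m n q w x y c.1 c.2 := by
  classical
  exact Finset.mem_filter

theorem innerSquare_subset_occurrenceHull {m n : ℕ} {q w : ℤ → ℤ → A}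
    (hw : Coverable m n q w) (k : ℕ) : innerSquare k ⊆ occurrenceHull m n q w k := by
  intro d hd
  obtain ⟨x, y, h⟩ := hw d.1 d.2
  exact mem_occurrenceHull.2 ⟨innerSquare_subset_outerBox m n k hd, x, y, h, d, hd, h⟩

theorem isPatch_occurrenceHull (m n : ℕ) (q w : ℤ → ℤ → A) (k : ℕ) :
    IsPatch m n q (occurrenceHull m n q w k) fun d => w d.1 d.2 := by
  intro d hd
  obtain ⟨-, x, y, h, c, hc, hcov⟩ := mem_occurrenceHull.1 hd
  refine ⟨x, y, fun i j hi hi' hj hj' => ⟨mem_occurrenceHull.2 ⟨?_, x, y, ?_, c, hc, hcov⟩,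
    h.1 i j hi hi' hj hj'⟩, h.2⟩
  · obtain ⟨-, h₁, h₂, h₃, h₄⟩ := hcov
    simp only [innerSquare, outerBox, Finset.mem_product, Finset.mem_Ico] at hc ⊢
    omega
  · exact ⟨h.1, by dsimp only; omega, by dsimp only; omega, by dsimp only; omega,
      by dsimp only; omega⟩

/-- Without interchangeable pairs, a square block of a coverable configuration is determined by
the shape of a hull of it, hence by a subset of a frame of linear size. -/
theorem card_langSq_le_s7 {m n : ℕ} {q : ℤ → ℤ → A}
    (h : ¬∃ (D : Finset (ℤ × ℤ)) (p₁ p₂ : ℤ × ℤ → A), InterchangeablePair m n q D p₁ p₂)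
    (k : ℕ) : Nat.card (LangSq (Xq m n q) k) ≤ 2 ^ (2 * (m + n) * k + 4 * m * n) := by
  have key : ∀ b : LangSq (Xq m n q) k, ∃ w : ℤ → ℤ → A, Coverable m n q w ∧
      ∀ i j : Fin k, w i j = b.1 i j := by
    rintro ⟨b, w, hw, x, y, hb⟩
    exact ⟨_, Coverable.shift hw x y, hb⟩
  choose w hw hb using key
  let f : LangSq (Xq m n q) k → (outerBox m n k \ innerSquare k).powerset := fun b =>
    ⟨occurrenceHull m n q (w b) k \ innerSquare k, Finset.mem_powerset.2
      (Finset.sdiff_subset_sdiff (fun _ hd => (mem_occurrenceHull.1 hd).1) subset_rfl)⟩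
  have hf : Function.Injective f := by
    intro b b' hbb
    have hD : occurrenceHull m n q (w b) k = occurrenceHull m n q (w b') k := by
      rw [← Finset.sdiff_union_of_subset (innerSquare_subset_occurrenceHull (hw b) k),
        ← Finset.sdiff_union_of_subset (innerSquare_subset_occurrenceHull (hw b') k),
        show _ \ _ = _ \ _ from Subtype.ext_iff.1 hbb]
    by_contra hne
    refine hne (Subtype.ext (funext₂ fun i j => ?_))
    by_contra hij
    refine h ⟨_, _, _, isPatch_occurrenceHull m n q (w b) k,
      hD ▸ isPatch_occurrenceHull m n q (w b') k, ((i : ℤ), (j : ℤ)),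
      innerSquare_subset_occurrenceHull (hw b) k ?_, ?_⟩
    · simp [innerSquare]
    · simpa only [hb] using hij
  calc Nat.card (LangSq (Xq m n q) k)
      ≤ Nat.card (outerBox m n k \ innerSquare k).powerset :=
        Nat.card_le_card_of_injective f hf
    _ = _ := by
        rw [Nat.card_eq_fintype_card, Fintype.card_coe, Finset.card_powerset,
          card_outerBox_sdiff_innerSquare]

theorem tendsto_linear_div_sq (a b : ℝ) :
    Tendsto (fun k : ℕ => (a * k + b) / (k : ℝ) ^ 2) atTop (nhds 0) := by
  have h₁ := (tendsto_const_div_atTop_nhds_zero_nat a).add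
    ((tendsto_const_div_atTop_nhds_zero_nat b).mul (tendsto_const_div_atTop_nhds_zero_nat 1))
  simp only [mul_zero, add_zero] at h₁
  refine h₁.congr' ?_
  filter_upwards [eventually_gt_atTop 0] with k hk
  have : (k : ℝ) ≠ 0 := by positivity
  field_simp

/-- if `q` is a primitive block and the subshift `X_q` has strictly
positive topological entropy, then there exists an interchangeable pair for `q`. -/
theorem interchangeable_of_pos_entropy {A : Type*} [Fintype A] (m n : ℕ)
    (hm : 0 < m) (hn : 0 < n) (q : ℤ → ℤ → A) (hq : Primitive m n q)
    (hpos : 0 < entropy2D (Xq m n q)) :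
    ∃ (D : Finset (ℤ × ℤ)) (p₁ p₂ : ℤ × ℤ → A), InterchangeablePair m n q D p₁ p₂ := by
  by_contra h
  refine hpos.ne' (Tendsto.limsup_eq (squeeze_zero (fun k => ?_) (fun k => ?_)
    (tendsto_linear_div_sq (2 * (m + n)) (4 * m * n))))
  · rcases Nat.eq_zero_or_pos (Nat.card (LangSq (Xq m n q) k)) with h0 | h0
    · simp [h0]
    · have : (1 : ℝ) ≤ Nat.card (LangSq (Xq m n q) k) := by exact_mod_cast h0
      exact div_nonneg (Real.logb_nonneg one_lt_two this) (by positivity)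
  · gcongr
    rcases Nat.eq_zero_or_pos (Nat.card (LangSq (Xq m n q) k)) with h0 | h0
    · simp only [h0, Nat.cast_zero, Real.logb_zero]
      positivity
    · rw [Real.logb_le_iff_le_rpow one_lt_two (by exact_mod_cast h0)]
      calc (Nat.card (LangSq (Xq m n q) k) : ℝ)
          ≤ ((2 ^ (2 * (m + n) * k + 4 * m * n) : ℕ) : ℝ) := by
            exact_mod_cast card_langSq_le_s7 h k
        _ = _ := by
            rw [Nat.cast_pow, ← Real.rpow_natCast]
            push_cast
            rfl
end

section
/- Let q be a block with |q| cells (|q| = mn for a block of size m × n). If there exists no interchangeable pair for q, then for every n ≥ 1 the number of n × n blocks occurring in configurations of X_q satisfies |L_{n,n}(X_q)| ≤ (n + 2|q|)² · |q|^{4n}; consequently h(X_q) = 0. -/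
open Filter

variable {A : Type*}

theorem Coverable.translate {m n : ℕ} {q w : ℤ → ℤ → A} (h : Coverable m n q w) (a b : ℤ) :
    Coverable m n q fun i j => w (a + i) (b + j) := by
  intro p₁ p₂
  obtain ⟨x, y, ho, h₁, h₂, h₃, h₄⟩ := h (a + p₁) (b + p₂)
  refine ⟨x - a, y - b, fun i j hi hi' hj hj' => ?_, by omega, by omega, by omega, by omega⟩
  have := ho i j hi hi' hj hj'
  simpa [← add_assoc] using this

/-- Among the occurrences covering a position there is one maximizing a given quantity. -/
theorem Coverable.exists_max_coversPos {m n : ℕ} {q w : ℤ → ℤ → A} (h : Coverable m n q w)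
    (g : ℤ × ℤ → ℤ) (p : ℤ × ℤ) :
    ∃ o : ℤ × ℤ, CoversPos m n q w o.1 o.2 p.1 p.2 ∧
      ∀ x y : ℤ, CoversPos m n q w x y p.1 p.2 → g (x, y) ≤ g o := by
  have hfin : {o : ℤ × ℤ | CoversPos m n q w o.1 o.2 p.1 p.2}.Finite := by
    refine (Finset.finite_toSet
      (Finset.Ioc (p.1 - m) p.1 ×ˢ Finset.Ioc (p.2 - n) p.2)).subset ?_
    rintro ⟨x, y⟩ ⟨-, h₁, h₂, h₃, h₄⟩
    simp only [Finset.coe_product, Set.mem_prod, Finset.mem_coe, Finset.mem_Ioc] at *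
    omega
  obtain ⟨x, y, hxy⟩ := h p.1 p.2
  obtain ⟨o, ho, hmax⟩ := Set.exists_max_image _ g hfin ⟨(x, y), hxy⟩
  exact ⟨o, ho, fun x y hxy => hmax (x, y) hxy⟩

/-- The cells on the left, right, bottom and top edges of the square `[0, N)²`. -/
def edgeCell (N : ℕ) (k : Fin 4 × Fin N) : ℤ × ℤ :=
  ![((0 : ℤ), (k.2 : ℤ)), ((N : ℤ) - 1, (k.2 : ℤ)), ((k.2 : ℤ), (0 : ℤ)),
    ((k.2 : ℤ), (N : ℤ) - 1)] k.1

/-- How far a point lies towards the inside, seen from the left, right, bottom and top edges. -/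
def inwardness (e : Fin 4) (o : ℤ × ℤ) : ℤ :=
  ![o.1, -o.1, o.2, -o.2] e

/-- The cells of an `m × n` rectangle with bottom-left corner `o`. -/
noncomputable def rectCells (m n : ℕ) (o : ℤ × ℤ) : Finset (ℤ × ℤ) :=
  Finset.Ico o.1 (o.1 + m) ×ˢ Finset.Ico o.2 (o.2 + n)

theorem mem_rectCells {m n : ℕ} {o p : ℤ × ℤ} :
    p ∈ rectCells m n o ↔ (o.1 ≤ p.1 ∧ p.1 < o.1 + m) ∧ o.2 ≤ p.2 ∧ p.2 < o.2 + n := by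
  simp [rectCells]

/-- The square `[0, N)²` together with one `m × n` rectangle for every edge cell; the rectangle
is given by the coordinates of the edge cell relative to it. -/
noncomputable def edgeDomain (m n N : ℕ) (f : Fin 4 × Fin N → Fin m × Fin n) : Finset (ℤ × ℤ) :=
  rectCells N N 0 ∪ Finset.univ.biUnion fun k =>
    rectCells m n ((edgeCell N k).1 - ((f k).1 : ℤ), (edgeCell N k).2 - ((f k).2 : ℤ))

theorem Coverable.exists_isPatch_edgeDomain {m n : ℕ} {q w : ℤ → ℤ → A}
    (h : Coverable m n q w) (N : ℕ) :
    ∃ f, IsPatch m n q (edgeDomain m n N f) fun d => w d.1 d.2 := by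
  choose o ho hmax using fun k : Fin 4 × Fin N =>
    h.exists_max_coversPos (inwardness k.1) (edgeCell N k)
  have hcode : ∀ k, ∃ c : Fin m × Fin n,
      ((edgeCell N k).1 - (c.1 : ℤ), (edgeCell N k).2 - (c.2 : ℤ)) = o k := by
    intro k
    obtain ⟨-, h₁, h₂, h₃, h₄⟩ := ho k
    refine ⟨(⟨((edgeCell N k).1 - (o k).1).toNat, by omega⟩,
      ⟨((edgeCell N k).2 - (o k).2).toNat, by omega⟩), Prod.ext ?_ ?_⟩ <;> simp <;> omega
  choose f hf using hcode
  refine ⟨f, ?_⟩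
  have hD : edgeDomain m n N f =
      rectCells N N 0 ∪ Finset.univ.biUnion fun k => rectCells m n (o k) := by
    simp only [edgeDomain, hf]
  rw [hD]
  have hedge : ∀ k, ∀ d ∈ rectCells m n (o k), ∃ x y : ℤ,
      PatchOccursAt m n q (rectCells N N 0 ∪ Finset.univ.biUnion fun k => rectCells m n (o k))
        (fun d => w d.1 d.2) x y ∧
      x ≤ d.1 ∧ d.1 < x + (m : ℤ) ∧ y ≤ d.2 ∧ d.2 < y + (n : ℤ) := by
    intro k d hd
    have hd' := mem_rectCells.1 hd
    refine ⟨(o k).1, (o k).2, fun i j hi hi' hj hj' => ⟨?_, (ho k).1 i j hi hi' hj hj'⟩,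
      hd'.1.1, hd'.1.2, hd'.2.1, hd'.2.2⟩
    refine Finset.mem_union_right _ (Finset.mem_biUnion.2 ⟨k, Finset.mem_univ k, ?_⟩)
    rw [mem_rectCells]
    constructor <;> constructor <;> simp <;> omega
  intro d hd
  rcases Finset.mem_union.1 hd with hd | hd
  swap
  · obtain ⟨k, -, hk⟩ := Finset.mem_biUnion.1 hd
    exact hedge k d hk
  obtain ⟨d₁, d₂⟩ := d
  simp only [mem_rectCells, Prod.fst_zero, Prod.snd_zero, zero_add] at hd
  obtain ⟨⟨a₁, a₂⟩, a₃, a₄⟩ := hd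
  lift d₁ to ℕ using a₁
  lift d₂ to ℕ using a₃
  norm_cast at a₂ a₄
  obtain ⟨x, y, hocc, h₁, h₂, h₃, h₄⟩ := h d₁ d₂
  by_cases hin : 0 ≤ x ∧ x + m ≤ N ∧ 0 ≤ y ∧ y + n ≤ N
  · refine ⟨x, y, fun i j hi hi' hj hj' => ⟨?_, hocc i j hi hi' hj hj'⟩, h₁, h₂, h₃, h₄⟩
    refine Finset.mem_union_left _ (mem_rectCells.2 ?_)
    constructor <;> constructor <;> simp <;> omega
  have hcross : x < 0 ∨ (N : ℤ) < x + m ∨ y < 0 ∨ (N : ℤ) < y + n := by omega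
  have key : ∃ k, ((d₁ : ℤ), (d₂ : ℤ)) ∈ rectCells m n (o k) := by
    simp only [mem_rectCells]
    rcases hcross with hc | hc | hc | hc
    · refine ⟨(0, ⟨d₂, a₄⟩), ?_⟩
      have c := ho (0, ⟨d₂, a₄⟩)
      have g := hmax (0, ⟨d₂, a₄⟩) x y
      simp only [CoversPos, edgeCell, inwardness] at c g
      simp at c g
      have := g hocc (by omega) (by omega) (by omega) (by omega)
      omega
    · refine ⟨(1, ⟨d₂, a₄⟩), ?_⟩
      have c := ho (1, ⟨d₂, a₄⟩)
      have g := hmax (1, ⟨d₂, a₄⟩) x y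
      simp only [CoversPos, edgeCell, inwardness] at c g
      simp at c g
      have := g hocc (by omega) (by omega) (by omega) (by omega)
      omega
    · refine ⟨(2, ⟨d₁, a₂⟩), ?_⟩
      have c := ho (2, ⟨d₁, a₂⟩)
      have g := hmax (2, ⟨d₁, a₂⟩) x y
      simp only [CoversPos, edgeCell, inwardness] at c g
      simp at c g
      have := g hocc (by omega) (by omega) (by omega) (by omega)
      omega
    · refine ⟨(3, ⟨d₁, a₂⟩), ?_⟩
      have c := ho (3, ⟨d₁, a₂⟩)
      have g := hmax (3, ⟨d₁, a₂⟩) x y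
      simp only [CoversPos, edgeCell, inwardness] at c g
      simp at c g
      have := g hocc (by omega) (by omega) (by omega) (by omega)
      omega
  obtain ⟨k, hk⟩ := key
  exact hedge k _ hk

theorem card_langSq_Xq_le {m n : ℕ} {q : ℤ → ℤ → A}
    (hno : ¬ ∃ (D : Finset (ℤ × ℤ)) (p₁ p₂ : ℤ × ℤ → A), InterchangeablePair m n q D p₁ p₂)
    (N : ℕ) : Nat.card (LangSq (Xq m n q) N) ≤ (m * n) ^ (4 * N) := by
  have hpatch : ∀ b : LangSq (Xq m n q) N, ∃ f : Fin 4 × Fin N → Fin m × Fin n,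
      ∃ p : ℤ × ℤ → A, IsPatch m n q (edgeDomain m n N f) p ∧
        ∀ i j : Fin N, p ((i : ℤ), (j : ℤ)) = b.1 i j := by
    rintro ⟨b, w, hw, x, y, hb⟩
    obtain ⟨f, hf⟩ := (Coverable.translate hw x y).exists_isPatch_edgeDomain N
    exact ⟨f, _, hf, hb⟩
  choose f p hp hb using hpatch
  have hinj : Function.Injective f := by
    intro b c hbc
    by_contra hne
    refine hno ⟨edgeDomain m n N (f b), p b, p c, hp b, hbc ▸ hp c, ?_⟩
    by_contra! heq
    refine hne (Subtype.ext (funext fun i => funext fun j => ?_))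
    rw [← hb b, ← hb c]
    refine heq _ (Finset.mem_union_left _ (mem_rectCells.2 ?_))
    simp
  simpa using Nat.card_le_card_of_injective f hinj

theorem entropy2D_eq_zero_of_card_le {X : Set (ℤ → ℤ → A)} {c : ℕ}
    (h : ∀ N : ℕ, Nat.card (LangSq X N) ≤ c ^ (4 * N)) : entropy2D X = 0 := by
  refine Tendsto.limsup_eq ?_
  have hlim : Tendsto (fun k : ℕ => 4 * Real.logb 2 c / (k : ℝ)) atTop (nhds 0) :=
    tendsto_const_div_atTop_nhds_zero_nat _
  refine squeeze_zero (fun k => ?_) (fun k => ?_) hlim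
  · exact div_nonneg (div_nonneg (Real.log_natCast_nonneg _) (Real.log_nonneg (by norm_num)))
      (by positivity)
  rcases Nat.eq_zero_or_pos k with rfl | hk
  · simp
  have hk' : (0 : ℝ) < k := by exact_mod_cast hk
  have hlog : Real.logb 2 (Nat.card (LangSq X k)) ≤ 4 * k * Real.logb 2 c := by
    rcases Nat.eq_zero_or_pos (Nat.card (LangSq X k)) with h0 | h0
    · rw [h0]
      simp only [Nat.cast_zero, Real.logb_zero]
      exact mul_nonneg (by positivity)
        (div_nonneg (Real.log_natCast_nonneg _) (Real.log_nonneg (by norm_num)))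
    · have hle : (Nat.card (LangSq X k) : ℝ) ≤ (c : ℝ) ^ (4 * k) := by exact_mod_cast h k
      have := Real.logb_le_logb_of_le (b := 2) (by norm_num) (by exact_mod_cast h0) hle
      rw [Real.logb_pow] at this
      exact_mod_cast this
  rw [div_le_div_iff₀ (by positivity) hk']
  nlinarith [mul_le_mul_of_nonneg_right hlog hk'.le]

/-- if there is no interchangeable pair for the `m × n` block `q`
(with `|q| = mn` cells), then for every `N ≥ 1` we have
`|L_{N,N}(X_q)| ≤ (N + 2|q|)² · |q|^(4N)`; consequently `h(X_q) = 0`. -/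
theorem zero_entropy_of_no_interchangeable {A : Type*} [Fintype A] (m n : ℕ)
    (hm : 0 < m) (hn : 0 < n) (q : ℤ → ℤ → A)
    (hno : ¬ ∃ (D : Finset (ℤ × ℤ)) (p₁ p₂ : ℤ × ℤ → A),
      InterchangeablePair m n q D p₁ p₂) :
    (∀ N : ℕ, 1 ≤ N →
      Nat.card (LangSq (Xq m n q) N) ≤ (N + 2 * (m * n)) ^ 2 * (m * n) ^ (4 * N)) ∧
    entropy2D (Xq m n q) = 0 := by
  refine ⟨fun N hN => (card_langSq_Xq_le hno N).trans ?_,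
    entropy2D_eq_zero_of_card_le (card_langSq_Xq_le hno)⟩
  exact Nat.le_mul_of_pos_left _ (by positivity)
end
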